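/- Let 0 < c < 1. Then for every real λ > 1, λ^{−c}(λ − 1)^{c−1} = (sin(πc)/π) ∫₀¹ v^{−c}(1 − v)^{c−1}/(λ − v) dv, the integral converging absolutely. (Equivalently, writing u = −v, λ^{−c}(λ−1)^{c−1} = (sin(πc)/π) ∫_{−1}^0 (−u)^{−c}(1+u)^{c−1}/(λ+u) du.) In particular, λ ↦ λ^{−c}(λ−1)^{c−1} is operator monotone decreasing on (1, ∞). -/

import Mathlib

open MeasureTheory Set Real

theorem setIntegral_rpow_mul_one_sub_rpow {α β : ℝ} (hα : 0 < α) (hβ : 0 < β) :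
    ∫ x in Ioo (0 : ℝ) 1, x ^ (α - 1) * (1 - x) ^ (β - 1) = ProbabilityTheory.beta α β := by
  rw [ProbabilityTheory.beta_eq_betaIntegralReal α β hα hβ, Complex.betaIntegral,
    intervalIntegral.integral_of_le zero_le_one, ← integral_Ioc_eq_integral_Ioo,
    ← Complex.ofReal_re (∫ x in Ioc (0 : ℝ) 1, x ^ (α - 1) * (1 - x) ^ (β - 1)),
    ← integral_complex_ofReal]
  congr 1
  refine setIntegral_congr_fun measurableSet_Ioc fun x hx ↦ ?_
  simp only [Complex.ofReal_mul, Complex.ofReal_cpow hx.1.le,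
    Complex.ofReal_cpow (sub_nonneg.2 hx.2)]
  norm_cast

theorem integrableOn_rpow_mul_one_sub_rpow {α β : ℝ} (hα : 0 < α) (hβ : 0 < β) :
    IntegrableOn (fun x : ℝ ↦ x ^ (α - 1) * (1 - x) ^ (β - 1)) (Ioo 0 1) := by
  refine not_imp_comm.1 integral_undef ?_
  rw [setIntegral_rpow_mul_one_sub_rpow hα hβ]
  exact (ProbabilityTheory.beta_pos hα hβ).ne'

/-- The Möbius map `v ↦ v (l - 1) / (l - v)` fixes `0` and `1`. -/
theorem hasDerivAt_mul_sub_one_div_sub {l v : ℝ} (hv : v < l) :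
    HasDerivAt (fun v : ℝ ↦ v * (l - 1) / (l - v)) (l * (l - 1) / (l - v) ^ 2) v := by
  have hne : l - v ≠ 0 := (sub_pos.2 hv).ne'
  convert! ((hasDerivAt_id v).mul_const (l - 1)).fun_div ((hasDerivAt_id v).const_sub l) hne using 1
  simp only [id]
  ring

theorem injOn_mul_sub_one_div_sub {l : ℝ} (hl : 1 < l) :
    InjOn (fun v : ℝ ↦ v * (l - 1) / (l - v)) (Ioo 0 1) := by
  intro v hv w hw h
  have h1 : l - v ≠ 0 := by linarith [hv.2]
  have h2 : l - w ≠ 0 := by linarith [hw.2]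
  have h3 : l * (l - 1) ≠ 0 := by nlinarith
  simp only [div_eq_div_iff h1 h2] at h
  refine mul_left_cancel₀ h3 ?_
  linear_combination h

theorem image_mul_sub_one_div_sub {l : ℝ} (hl : 1 < l) :
    (fun v : ℝ ↦ v * (l - 1) / (l - v)) '' Ioo 0 1 = Ioo 0 1 := by
  ext w
  constructor
  · rintro ⟨v, ⟨hv0, hv1⟩, rfl⟩
    have h1 : 0 < l - v := by linarith
    have h2 : 0 < l - 1 := by linarith
    refine ⟨by positivity, ?_⟩
    rw [div_lt_one h1]
    nlinarith
  · rintro ⟨hw0, hw1⟩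
    have h1 : 0 < l - 1 + w := by linarith
    refine ⟨w * l / (l - 1 + w), ⟨by positivity, ?_⟩, ?_⟩
    · rw [div_lt_one h1]
      nlinarith
    · have h2 : l - w * l / (l - 1 + w) = l * (l - 1) / (l - 1 + w) := by
        field_simp
        ring
      have h3 : l - 1 ≠ 0 := by linarith
      simp only [h2]
      field_simp

theorem abs_deriv_smul_beta_kernel_comp (c : ℝ) {l v : ℝ} (hl : 1 < l) (hv : v ∈ Ioo (0 : ℝ) 1) :
    |l * (l - 1) / (l - v) ^ 2| •
        ((v * (l - 1) / (l - v)) ^ (-c) * (1 - v * (l - 1) / (l - v)) ^ (c - 1)) =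
      (l ^ c * (l - 1) ^ (1 - c)) * (v ^ (-c) * (1 - v) ^ (c - 1) / (l - v)) := by
  obtain ⟨hv0, hv1⟩ := hv
  have hl0 : 0 < l := by linarith
  have hl1 : 0 < l - 1 := by linarith
  have hlv : 0 < l - v := by linarith
  have hv1' : 0 < 1 - v := by linarith
  have hsub : 1 - v * (l - 1) / (l - v) = l * (1 - v) / (l - v) := by
    field_simp
    ring
  rw [hsub, abs_of_pos (by positivity), smul_eq_mul,
    div_rpow (by positivity) hlv.le, div_rpow (by positivity) hlv.le,
    mul_rpow hv0.le hl1.le, mul_rpow hl0.le hv1'.le,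
    rpow_sub_one hl0.ne', rpow_sub_one hlv.ne', rpow_neg hl1.le, rpow_neg hlv.le,
    rpow_sub hl1, rpow_one]
  have := rpow_pos_of_pos hlv c
  have := rpow_pos_of_pos hl1 c
  field_simp

/-- the Loewner-type integral representation
`λ^{-c}(λ-1)^{c-1} = (sin πc / π) ∫₀¹ v^{-c}(1-v)^{c-1}/(λ-v) dv` for `0 < c < 1`
and `λ > 1`, the integral converging absolutely; in particular the function
`λ ↦ λ^{-c}(λ-1)^{c-1}` is (operator) monotone decreasing on `(1,∞)`. -/
theorem stmt5 (c : ℝ) (hc0 : 0 < c) (hc1 : c < 1) :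
    (∀ lam : ℝ, 1 < lam →
      MeasureTheory.IntegrableOn
        (fun v : ℝ => v ^ (-c) * (1 - v) ^ (c - 1) / (lam - v)) (Set.Ioo 0 1) ∧
      lam ^ (-c) * (lam - 1) ^ (c - 1) =
        (Real.sin (Real.pi * c) / Real.pi) *
          ∫ v in Set.Ioo (0:ℝ) 1, v ^ (-c) * (1 - v) ^ (c - 1) / (lam - v)) ∧
    AntitoneOn (fun lam : ℝ => lam ^ (-c) * (lam - 1) ^ (c - 1)) (Set.Ioi 1) := by
  have hexp : (1 - c) - 1 = -c := by ring
  constructor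
  · intro l hl
    have hl0 : 0 < l := by linarith
    have hl1 : 0 < l - 1 := by linarith
    have hK : 0 < l ^ c * (l - 1) ^ (1 - c) := by positivity
    have hderiv : ∀ v ∈ Ioo (0 : ℝ) 1, HasDerivWithinAt (fun v : ℝ ↦ v * (l - 1) / (l - v))
        (l * (l - 1) / (l - v) ^ 2) (Ioo 0 1) v := fun v hv ↦
      (hasDerivAt_mul_sub_one_div_sub (hv.2.trans hl)).hasDerivWithinAt
    have hint := integrableOn_rpow_mul_one_sub_rpow (sub_pos.2 hc1) hc0
    have hval := setIntegral_rpow_mul_one_sub_rpow (sub_pos.2 hc1) hc0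
    rw [hexp, ← image_mul_sub_one_div_sub hl] at hint hval
    rw [integrableOn_image_iff_integrableOn_abs_deriv_smul measurableSet_Ioo hderiv
      (injOn_mul_sub_one_div_sub hl), integrableOn_congr_fun
      (fun v hv ↦ abs_deriv_smul_beta_kernel_comp c hl hv) measurableSet_Ioo] at hint
    rw [integral_image_eq_integral_abs_deriv_smul measurableSet_Ioo hderiv
      (injOn_mul_sub_one_div_sub hl), setIntegral_congr_fun measurableSet_Ioo
      (fun v hv ↦ abs_deriv_smul_beta_kernel_comp c hl hv), integral_const_mul,
      ProbabilityTheory.beta, sub_add_cancel, Gamma_one, div_one, mul_comm (Gamma _),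
      Gamma_mul_Gamma_one_sub] at hval
    refine ⟨(integrable_const_mul_iff hK.ne'.isUnit _).1 hint, ?_⟩
    have hsin : 0 < sin (π * c) :=
      sin_pos_of_pos_of_lt_pi (by positivity) (mul_lt_of_lt_one_right pi_pos hc1)
    rw [mul_comm, ← eq_div_iff hK.ne'] at hval
    rw [hval, rpow_neg hl0.le, ← neg_sub 1 c, rpow_neg hl1.le]
    generalize sin (π * c) = s at hsin ⊢
    field_simp
  · intro x hx y hy hxy
    have hx1 : 0 < x - 1 := sub_pos.2 hx
    have hy1 : 0 < y - 1 := sub_pos.2 hy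
    have hx0 : 0 < x := by linarith
    exact mul_le_mul (rpow_le_rpow_of_nonpos hx0 hxy (by linarith))
      (rpow_le_rpow_of_nonpos hx1 (by linarith) (by linarith)) (by positivity) (by positivity)
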